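/- Let A be a commutative noetherian ring, let C be a semi-dualizing module for A, let I be an injective A-module, and let M be an A-module of finite projective dimension. Then Ext^i_A(M, Hom_A(C, I)) = 0 for all i ≥ 1. -/

import Mathlib

/-- `Ext^i_R(M, N)` for modules `M`, `N` over a commutative ring `R`. -/
noncomputable abbrev ExtGroup (R : Type) [CommRing R] (i : ℕ)
    (M : Type) [AddCommGroup M] [Module R M] (N : Type) [AddCommGroup N] [Module R N] : Type :=
  ((Ext R (ModuleCat R) i).obj (Opposite.op (ModuleCat.of R M))).obj (ModuleCat.of R N)

/-- `C` is a semi-dualizing module for `A`: it is finitely generated, the canonical map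
`A → Hom_A(C,C)`, `a ↦ (a • ·)`, is bijective, and `Ext^i_A(C,C) = 0` for `i ≥ 1`. -/
def IsSemidualizing (A : Type) [CommRing A] (C : Type) [AddCommGroup C] [Module A C] : Prop :=
  Module.Finite A C ∧ Function.Bijective (LinearMap.lsmul A C) ∧
    ∀ i : ℕ, 1 ≤ i → Subsingleton (ExtGroup A i C C)

/-- A module `M` over a commutative ring `R` has finite projective dimension, i.e. it admits
a finite-length projective resolution: equivalently (and this is how we phrase it), there is
an `n` such that `Ext^i_R(M, N) = 0` for all `i > n` and all `R`-modules `N`. -/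
def HasFiniteProjDim (R : Type) [CommRing R] (M : Type) [AddCommGroup M] [Module R M] : Prop :=
  ∃ n : ℕ, ∀ i : ℕ, n < i → ∀ (N : Type) [AddCommGroup N] [Module R N],
    Subsingleton (ExtGroup R i M N)

open CategoryTheory TensorProduct

/-- In positive degrees, the left derived functor `Ext` and the derived category `Abelian.Ext`
vanish simultaneously. -/
theorem subsingleton_extGroup_succ_iff (R : Type) [CommRing R] (n : ℕ)
    (M : Type) [AddCommGroup M] [Module R M] (N : Type) [AddCommGroup N] [Module R N] :
    Subsingleton (ExtGroup R (n + 1) M N) ↔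
      Subsingleton (Abelian.Ext (ModuleCat.of R M) (ModuleCat.of R N) (n + 1)) := by
  let P := projectiveResolution (ModuleCat.of R M)
  have hex : Subsingleton (ExtGroup R (n + 1) M N) ↔
      ∀ f : P.complex.X (n + 1) ⟶ ModuleCat.of R N, P.complex.d (n + 2) (n + 1) ≫ f = 0 →
        ∃ g : P.complex.X n ⟶ ModuleCat.of R N, P.complex.d (n + 1) n ≫ g = f := by
    rw [← ModuleCat.isZero_iff_subsingleton, (P.isoExt (n + 1) (ModuleCat.of R N)).isZero_iff,
      ← HomologicalComplex.exactAt_iff_isZero_homology,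
      HomologicalComplex.exactAt_iff' _ n (n + 1) (n + 2) (by simp) (by simp),
      ShortComplex.moduleCat_exact_iff]
    rfl
  rw [hex]
  constructor
  · intro h
    refine subsingleton_of_forall_eq 0 fun x => ?_
    obtain ⟨f, hf, rfl⟩ := P.extMk_surjective x (n + 2) rfl
    exact (P.extMk_eq_zero_iff f _ rfl hf n rfl).2 (h f hf)
  · intro h f hf
    exact (P.extMk_eq_zero_iff f _ rfl hf n rfl).1 (Subsingleton.elim _ _)

/-- A finitely generated faithful module over a noetherian ring has a nonzero map to
every nonzero module. -/
theorem subsingleton_of_subsingleton_linearMap {A C K : Type*} [CommRing A] [IsNoetherianRing A]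
    [AddCommGroup C] [Module A C] [Module.Finite A C]
    (hC : Function.Injective (LinearMap.lsmul A C))
    [AddCommGroup K] [Module A K] [Subsingleton (C →ₗ[A] K)] : Subsingleton K := by
  refine subsingleton_of_forall_eq 0 fun x => ?_
  let N : Submodule A K := Submodule.span A {x}
  have hN : Subsingleton (C →ₗ[A] N) := by
    refine subsingleton_of_forall_eq 0 fun f => ?_
    have h : N.subtype ∘ₗ f = 0 := Subsingleton.elim _ _
    ext c
    exact LinearMap.congr_fun h c
  obtain ⟨r, hr, hreg⟩ := IsSMulRegular.subsingleton_linearMap_iff.1 hN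
  have hr0 : r = 0 := hC (by
    ext c
    simpa using Module.mem_annihilator.1 hr c)
  subst hr0
  have h0 : (⟨x, Submodule.mem_span_singleton_self x⟩ : N) = 0 := hreg (by simp)
  exact congrArg Subtype.val h0

section DimensionShift

variable {A : Type} [CommRing A] {F D : Type} [AddCommGroup F] [Module A F]
  [AddCommGroup D] [Module A D] [Module.Projective A F] {f : F →ₗ[A] D}

theorem subsingleton_ext_add_two_iff (hf : Function.Surjective f)
    (N : Type) [AddCommGroup N] [Module A N] (n : ℕ) :
    Subsingleton (Abelian.Ext (ModuleCat.of A D) (ModuleCat.of A N) (n + 2)) ↔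
      Subsingleton (Abelian.Ext (ModuleCat.of A f.ker) (ModuleCat.of A N) (n + 1)) := by
  have hS := LinearMap.shortExact_shortComplexKer hf
  have : Projective f.shortComplexKer.X₂ := inferInstanceAs (Projective (ModuleCat.of A F))
  constructor
  · intro h
    refine subsingleton_of_forall_eq 0 fun x => ?_
    obtain ⟨y, rfl⟩ := Abelian.Ext.contravariant_sequence_exact₁ hS _ x (n₁ := n + 2) (by omega)
      (Subsingleton.elim (α := Abelian.Ext (ModuleCat.of A D) (ModuleCat.of A N) (n + 2)) _ _)
    rw [Abelian.Ext.eq_zero_of_projective y, Abelian.Ext.comp_zero]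
  · intro h
    refine subsingleton_of_forall_eq 0 fun x => ?_
    obtain ⟨y, rfl⟩ := Abelian.Ext.contravariant_sequence_exact₃ hS _ x
      (Abelian.Ext.eq_zero_of_projective _) (n₀ := n + 1) (by omega)
    have hy : y = 0 :=
      Subsingleton.elim (α := Abelian.Ext (ModuleCat.of A f.ker) (ModuleCat.of A N) (n + 1)) _ _
    rw [hy, Abelian.Ext.comp_zero]

theorem subsingleton_ext_one_iff (hf : Function.Surjective f)
    (N : Type) [AddCommGroup N] [Module A N] :
    Subsingleton (Abelian.Ext (ModuleCat.of A D) (ModuleCat.of A N) 1) ↔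
      ∀ g : f.ker →ₗ[A] N, ∃ h : F →ₗ[A] N, h ∘ₗ f.ker.subtype = g := by
  have hS := LinearMap.shortExact_shortComplexKer hf
  have : Projective f.shortComplexKer.X₂ := inferInstanceAs (Projective (ModuleCat.of A F))
  constructor
  · intro h g
    obtain ⟨y, hy⟩ := Abelian.Ext.contravariant_sequence_exact₁ hS _
      (Abelian.Ext.mk₀ (ModuleCat.ofHom g)) (n₁ := 1) (by omega)
      (Subsingleton.elim (α := Abelian.Ext (ModuleCat.of A D) (ModuleCat.of A N) 1) _ _)
    obtain ⟨y, rfl⟩ := Abelian.Ext.addEquiv₀.symm.surjective y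
    refine ⟨y.hom, ?_⟩
    rw [Abelian.Ext.addEquiv₀_symm_apply, Abelian.Ext.mk₀_comp_mk₀] at hy
    exact congrArg ModuleCat.Hom.hom ((Abelian.Ext.mk₀_bijective _ _).1 hy)
  · intro h
    refine subsingleton_of_forall_eq 0 fun x => ?_
    obtain ⟨y, rfl⟩ := Abelian.Ext.contravariant_sequence_exact₃ hS _ x
      (Abelian.Ext.eq_zero_of_projective _) (n₀ := 0) (by omega)
    obtain ⟨y, rfl⟩ := Abelian.Ext.addEquiv₀.symm.surjective y
    obtain ⟨z, hz⟩ := h y.hom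
    have hy : y = f.shortComplexKer.f ≫ ModuleCat.ofHom z := ModuleCat.hom_ext hz.symm
    rw [Abelian.Ext.addEquiv₀_symm_apply, hy, ← Abelian.Ext.mk₀_comp_mk₀,
      ShortComplex.ShortExact.extClass_comp_assoc]

end DimensionShift

/-- `Abelian.Ext` vanishing in the second variable passes to retracts. -/
theorem subsingleton_ext_of_retract {A : Type} [CommRing A] {X N N' : Type}
    [AddCommGroup X] [Module A X] [AddCommGroup N] [Module A N] [AddCommGroup N'] [Module A N']
    (s : N →ₗ[A] N') (r : N' →ₗ[A] N) (hrs : r ∘ₗ s = LinearMap.id) (n : ℕ)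
    [Subsingleton (Abelian.Ext (ModuleCat.of A X) (ModuleCat.of A N') n)] :
    Subsingleton (Abelian.Ext (ModuleCat.of A X) (ModuleCat.of A N) n) := by
  refine subsingleton_of_forall_eq 0 fun x => ?_
  have hid : ModuleCat.ofHom s ≫ ModuleCat.ofHom r = 𝟙 (ModuleCat.of A N) :=
    ModuleCat.hom_ext hrs
  have h0 : x.comp (Abelian.Ext.mk₀ (ModuleCat.ofHom s)) (add_zero n) = 0 :=
    Subsingleton.elim _ _
  rw [← Abelian.Ext.comp_mk₀_id x, ← hid, ← Abelian.Ext.mk₀_comp_mk₀,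
    ← Abelian.Ext.comp_assoc_of_second_deg_zero, h0, Abelian.Ext.zero_comp]

/-- A linear map from a finitely generated module to a direct sum has only finitely many nonzero
components. -/
theorem finite_setOf_lapply_comp_ne_zero {A K N ι : Type*} [CommRing A]
    [AddCommGroup K] [Module A K]
    [AddCommGroup N] [Module A N] [Module.Finite A K] (g : K →ₗ[A] (ι →₀ N)) :
    {i | Finsupp.lapply i ∘ₗ g ≠ 0}.Finite := by
  classical
  obtain ⟨S, hS⟩ := Module.Finite.fg_top (R := A) (M := K)
  refine (S.biUnion fun k => (g k).support).finite_toSet.subset fun i hi => ?_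
  by_contra hiS
  refine hi (LinearMap.ext_on hS fun k hk => ?_)
  by_contra hne
  exact hiS (by
    simp only [Finset.coe_biUnion, Set.mem_iUnion]
    exact ⟨k, hk, by simpa using hne⟩)

theorem subsingleton_ext_finsupp {A : Type} [CommRing A] [IsNoetherianRing A]
    (N : Type) [AddCommGroup N] [Module A N] (ι : Type) (n : ℕ)
    (D : Type) [AddCommGroup D] [Module A D] [Module.Finite A D]
    (h : Subsingleton (Abelian.Ext (ModuleCat.of A D) (ModuleCat.of A N) (n + 1))) :
    Subsingleton (Abelian.Ext (ModuleCat.of A D) (ModuleCat.of A (ι →₀ N)) (n + 1)) := by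
  induction n generalizing D with
  | zero =>
    obtain ⟨m, f, hf⟩ := Module.Finite.exists_fin' A D
    rw [subsingleton_ext_one_iff hf] at h ⊢
    intro g
    choose φ hφ using fun i => h (Finsupp.lapply i ∘ₗ g)
    have hfin := finite_setOf_lapply_comp_ne_zero g
    refine ⟨∑ i ∈ hfin.toFinset, Finsupp.lsingle i ∘ₗ φ i, ?_⟩
    ext k i
    have hk : φ i k = g k i := LinearMap.congr_fun (hφ i) k
    classical
    by_cases hi : Finsupp.lapply i ∘ₗ g = 0
    · have : g k i = 0 := LinearMap.congr_fun hi k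
      simp [Finsupp.finsetSum_apply, Finsupp.single_apply, hi, this]
    · simp [Finsupp.finsetSum_apply, Finsupp.single_apply, hi, hk]
  | succ n ih =>
    obtain ⟨m, f, hf⟩ := Module.Finite.exists_fin' A D
    rw [subsingleton_ext_add_two_iff hf] at h ⊢
    exact ih _ h

/-- The canonical map `M → Hom(C, C ⊗ M)` is bijective and `Ext^i(C, C ⊗ M) = 0` for `i ≥ 1`. -/
def IsHomTensorAcyclic (A C M : Type) [CommRing A] [AddCommGroup C] [Module A C]
    [AddCommGroup M] [Module A M] : Prop :=
  Function.Bijective (TensorProduct.mk A C M).flip ∧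
    ∀ i : ℕ, Subsingleton (Abelian.Ext (ModuleCat.of A C) (ModuleCat.of A (C ⊗[A] M)) (i + 1))

namespace IsHomTensorAcyclic

variable {A C : Type} [CommRing A] [AddCommGroup C] [Module A C]

theorem of_retract {M F : Type} [AddCommGroup M] [Module A M] [AddCommGroup F] [Module A F]
    (s : M →ₗ[A] F) (r : F →ₗ[A] M) (hrs : r ∘ₗ s = LinearMap.id)
    (hF : IsHomTensorAcyclic A C F) : IsHomTensorAcyclic A C M := by
  have hrs' (m : M) : r (s m) = m := LinearMap.congr_fun hrs m
  refine ⟨⟨fun m m' h => ?_, fun g => ?_⟩, fun i => ?_⟩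
  · have : s m = s m' := hF.1.1 (by
      ext c
      exact congrArg (s.lTensor C) (LinearMap.congr_fun h c))
    rw [← hrs' m, this, hrs']
  · obtain ⟨y, hy⟩ := hF.1.2 (s.lTensor C ∘ₗ g)
    refine ⟨r y, ?_⟩
    ext c
    have := congrArg (r.lTensor C) (LinearMap.congr_fun hy c)
    rwa [LinearMap.comp_apply, ← LinearMap.lTensor_comp_apply, hrs, LinearMap.lTensor_id] at this
  · have := hF.2 i
    exact subsingleton_ext_of_retract (s.lTensor C) (r.lTensor C)
      (by rw [← LinearMap.lTensor_comp, hrs, LinearMap.lTensor_id]) _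

variable [IsNoetherianRing A]

theorem finsupp (hC : IsSemidualizing A C) (ι : Type) : IsHomTensorAcyclic A C (ι →₀ A) := by
  classical
  obtain ⟨hfin, hbij, hext⟩ := hC
  let e : C ⊗[A] (ι →₀ A) ≃ₗ[A] (ι →₀ C) := TensorProduct.finsuppScalarRight A A C ι
  have he (c : C) (a : ι →₀ A) (i : ι) : e (c ⊗ₜ a) i = a i • c := by
    simp [e]
  refine ⟨⟨fun a b h => ?_, fun g => ?_⟩, fun i => ?_⟩
  · ext i
    refine hbij.1 (LinearMap.ext fun c => ?_)
    have := DFunLike.congr_fun (congrArg e (LinearMap.congr_fun h c)) i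
    simpa [he] using this
  · choose a ha using fun i => hbij.2 (Finsupp.lapply i ∘ₗ e.toLinearMap ∘ₗ g)
    have hfin := finite_setOf_lapply_comp_ne_zero (e.toLinearMap ∘ₗ g)
    refine ⟨Finsupp.ofSupportFinite a (hfin.subset fun i hi h0 => hi (hbij.1 ?_)), ?_⟩
    · rw [ha, h0, map_zero]
    · ext c
      refine e.injective (Finsupp.ext fun i => ?_)
      have := LinearMap.congr_fun (ha i) c
      simpa [he, Finsupp.ofSupportFinite_coe] using this
  · have := subsingleton_ext_finsupp C ι i C
      ((subsingleton_extGroup_succ_iff A i C C).1 (hext _ (by omega)))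
    exact subsingleton_ext_of_retract e.toLinearMap e.symm.toLinearMap (by ext; simp) _

theorem projective (hC : IsSemidualizing A C) (M : Type) [AddCommGroup M] [Module A M]
    [Module.Projective A M] : IsHomTensorAcyclic A C M := by
  obtain ⟨s, hs⟩ := Module.projective_def.1 ‹Module.Projective A M›
  exact of_retract s (Finsupp.linearCombination A id) (LinearMap.ext hs) (finsupp hC M)

variable {M F : Type} [AddCommGroup M] [Module A M] [AddCommGroup F] [Module A F]
  {f : F →ₗ[A] M}

theorem lTensor_subtype_injective (hC : IsSemidualizing A C)
    (hF : IsHomTensorAcyclic A C F) (hK : IsHomTensorAcyclic A C f.ker) :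
    Function.Injective (f.ker.subtype.lTensor C) := by
  have := hC.1
  have hsub : Subsingleton (C →ₗ[A] (f.ker.subtype.lTensor C).ker) := by
    refine subsingleton_of_forall_eq 0 fun g => ?_
    obtain ⟨w, hw⟩ := hK.1.2 (Submodule.subtype _ ∘ₗ g)
    have hg (c : C) : c ⊗ₜ[A] w = (g c : C ⊗[A] f.ker) := LinearMap.congr_fun hw c
    have hw0 : (w : F) = 0 := hF.1.1 (by
      ext c
      have := (g c).2
      rw [← hg] at this
      simpa using this)
    ext c
    rw [← hg, show w = 0 from Subtype.ext hw0]
    simp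
  have := subsingleton_of_subsingleton_linearMap hC.2.1.1
    (K := (f.ker.subtype.lTensor C).ker)
  exact LinearMap.ker_eq_bot.1 (Submodule.subsingleton_iff_eq_bot.1 this)

theorem of_ker (hC : IsSemidualizing A C) (hf : Function.Surjective f)
    (hF : IsHomTensorAcyclic A C F) (hK : IsHomTensorAcyclic A C f.ker) :
    IsHomTensorAcyclic A C M := by
  have hinj := lTensor_subtype_injective hC hF hK
  have hexact : Function.Exact (f.ker.subtype.lTensor C) (f.lTensor C) :=
    lTensor_exact C f.exact_subtype_ker_map hf
  have hsurj : Function.Surjective (f.lTensor C) := LinearMap.lTensor_surjective C hf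
  let S : ShortComplex (ModuleCat A) :=
    ShortComplex.mk (ModuleCat.ofHom (f.ker.subtype.lTensor C)) (ModuleCat.ofHom (f.lTensor C))
      (ModuleCat.hom_ext hexact.linearMap_comp_eq_zero)
  have hS : S.ShortExact :=
    { exact := ModuleCat.shortComplex_exact _ hexact
      mono_f := (ModuleCat.mono_iff_injective _).2 hinj
      epi_g := (ModuleCat.epi_iff_surjective _).2 hsurj }
  have hX₁ (i : ℕ) : Subsingleton (Abelian.Ext (ModuleCat.of A C) S.X₁ (i + 1)) := hK.2 i
  have hX₂ (i : ℕ) : Subsingleton (Abelian.Ext (ModuleCat.of A C) S.X₂ (i + 1)) := hF.2 i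
  refine ⟨⟨(injective_iff_map_eq_zero _).2 fun m hm => ?_, fun g => ?_⟩, fun i => ?_⟩
  · obtain ⟨y, rfl⟩ := hf m
    have hrange (c : C) : c ⊗ₜ[A] y ∈ (f.ker.subtype.lTensor C).range :=
      (hexact _).1 (LinearMap.congr_fun hm c)
    let e := LinearEquiv.ofInjective _ hinj
    obtain ⟨w, hw⟩ := hK.1.2
      (e.symm.toLinearMap ∘ₗ ((TensorProduct.mk A C F).flip y).codRestrict _ hrange)
    have hwy : (w : F) = y := hF.1.1 (by
      ext c
      have := congrArg (f.ker.subtype.lTensor C) (LinearMap.congr_fun hw c)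
      have h2 := LinearEquiv.apply_symm_apply e ⟨c ⊗ₜ[A] y, hrange c⟩
      exact this.trans (congrArg Subtype.val h2))
    rw [← hwy]
    exact w.2
  · obtain ⟨x, hx⟩ := Abelian.Ext.covariant_sequence_exact₃ _ hS
      (Abelian.Ext.mk₀ (ModuleCat.ofHom g)) (zero_add 1) (Subsingleton.elim _ _)
    obtain ⟨x, rfl⟩ := Abelian.Ext.addEquiv₀.symm.surjective x
    rw [Abelian.Ext.addEquiv₀_symm_apply, Abelian.Ext.mk₀_comp_mk₀] at hx
    have hx' := congrArg ModuleCat.Hom.hom ((Abelian.Ext.mk₀_bijective _ _).1 hx)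
    obtain ⟨y, hy⟩ := hF.1.2 x.hom
    refine ⟨f y, ?_⟩
    ext c
    refine Eq.trans ?_ (LinearMap.congr_fun hx' c)
    exact congrArg (f.lTensor C) (LinearMap.congr_fun hy c)
  · refine subsingleton_of_forall_eq 0 fun x => ?_
    obtain ⟨y, rfl⟩ := Abelian.Ext.covariant_sequence_exact₃ _ hS x rfl (Subsingleton.elim _ _)
    rw [Subsingleton.elim y 0, Abelian.Ext.zero_comp]

end IsHomTensorAcyclic

theorem isHomTensorAcyclic_and_subsingleton_ext_hom {A : Type} [CommRing A] [IsNoetherianRing A]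
    {C : Type} [AddCommGroup C] [Module A C] (hC : IsSemidualizing A C)
    (I : Type) [AddCommGroup I] [Module A I] (hI : Module.Injective A I) (n : ℕ)
    (M : Type) [AddCommGroup M] [Module A M]
    (hM : HasProjectiveDimensionLT (ModuleCat.of A M) (n + 1)) :
    IsHomTensorAcyclic A C M ∧ ∀ i : ℕ,
      Subsingleton (Abelian.Ext (ModuleCat.of A M) (ModuleCat.of A (C →ₗ[A] I)) (i + 1)) := by
  induction n generalizing M with
  | zero =>
    have hproj : Projective (ModuleCat.of A M) := inferInstance
    have : Module.Projective A M := (IsProjective.iff_projective M).2 hproj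
    exact ⟨.projective hC M, fun i =>
      subsingleton_of_forall_eq 0 fun x => Abelian.Ext.eq_zero_of_projective x⟩
  | succ n ih =>
    let f : (M →₀ A) →ₗ[A] M := Finsupp.linearCombination A id
    have hf : Function.Surjective f := Finsupp.linearCombination_id_surjective A M
    have : Projective f.shortComplexKer.X₂ :=
      inferInstanceAs (Projective (ModuleCat.of A (M →₀ A)))
    obtain ⟨hK, hKext⟩ := ih f.ker
      (((LinearMap.shortExact_shortComplexKer hf).hasProjectiveDimensionLT_X₃_iff n this).1 hM)
    have hF : IsHomTensorAcyclic A C (M →₀ A) := .finsupp hC M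
    refine ⟨.of_ker hC hf hF hK, fun i => ?_⟩
    cases i with
    | zero =>
      refine (subsingleton_ext_one_iff hf _).2 fun g => ?_
      obtain ⟨h, hh⟩ := hI.out (f.ker.subtype.lTensor C)
        (IsHomTensorAcyclic.lTensor_subtype_injective hC hF hK) (TensorProduct.lift g.flip)
      refine ⟨(TensorProduct.curry h).flip, ?_⟩
      ext k c
      simpa using hh (c ⊗ₜ k)
    | succ i => exact (subsingleton_ext_add_two_iff hf _ i).2 (hKext i)

/-- Let `A` be a commutative noetherian ring, `C` a semi-dualizing
`A`-module, `I` an injective `A`-module and `M` an `A`-module of finite projective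
dimension.  Then `Ext^i_A(M, Hom_A(C, I)) = 0` for all `i ≥ 1`. -/
theorem ext_into_hom_semidualizing_vanishes
    (A : Type) [CommRing A] [IsNoetherianRing A]
    (C : Type) [AddCommGroup C] [Module A C] (hC : IsSemidualizing A C)
    (I : Type) [AddCommGroup I] [Module A I] (hI : Module.Injective A I)
    (M : Type) [AddCommGroup M] [Module A M] (hM : HasFiniteProjDim A M) :
    ∀ i : ℕ, 1 ≤ i → Subsingleton (ExtGroup A i M (C →ₗ[A] I)) := by
  obtain ⟨n, hn⟩ := hM
  have hlt : HasProjectiveDimensionLT (ModuleCat.of A M) (n + 1) := by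
    refine .mk fun i hi N x => ?_
    obtain ⟨i, rfl⟩ := Nat.exists_eq_succ_of_ne_zero (by omega : i ≠ 0)
    have := (subsingleton_extGroup_succ_iff A i M N).1 (hn (i + 1) hi N)
    exact Subsingleton.elim (α := Abelian.Ext (ModuleCat.of A M) (ModuleCat.of A N) (i + 1)) _ _
  intro i hi
  obtain ⟨i, rfl⟩ := Nat.exists_eq_succ_of_ne_zero (by omega : i ≠ 0)
  exact (subsingleton_extGroup_succ_iff A i M _).2
    ((isHomTensorAcyclic_and_subsingleton_ext_hom hC I hI n M hlt).2 i)
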